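/- Let N ≥ 4 be an integer, let p₁, …, p_m be distinct partitions of [k], and suppose ξ = ∑_{i=1}^m α_i ξ_{p_i} is nonzero. For each four-element subset κ of [k], define the vector η^κ ∈ ℂ^m by η^κ_j = 1 if κ ∈ cr(p_j) and η^κ_j = 0 otherwise. If span{η^κ : κ a four-element subset of [k]} = ℂ^m, then ⟨NC, ξ⟩ = P (equality of families meaning equality of each subspace C(k',ℓ')). -/

import Mathlib

open scoped Classical

/-- The block relation of a finite partition of `Fin n` (partition of `[n]`):
`x ∼_p y` iff `x` and `y` lie in the same block of `p`. -/
def PartRel {n : ℕ} (p : Finpartition (Finset.univ : Finset (Fin n))) (x y : Fin n) : Prop :=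
  ∃ B ∈ p.parts, x ∈ B ∧ y ∈ B

/-- `κ` is a crossing of the relation `r`: `κ = {a,b,c,d}` with `a < b < c < d`,
`r a c`, `r b d`, and `¬ r a b`. -/
def IsCross {n : ℕ} (r : Fin n → Fin n → Prop) (κ : Finset (Fin n)) : Prop :=
  ∃ a b c d : Fin n, a < b ∧ b < c ∧ c < d ∧ κ = {a, b, c, d} ∧ r a c ∧ r b d ∧ ¬ r a b

/-- `cr p`: the set of crossings of the partition `p`. -/
def cr {n : ℕ} (p : Finpartition (Finset.univ : Finset (Fin n))) : Set (Finset (Fin n)) :=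
  {κ | IsCross (PartRel p) κ}


/-- `crossers p` (`χ(p)`): the union of all crossings of `p`. -/
def crossers {n : ℕ} (p : Finpartition (Finset.univ : Finset (Fin n))) : Set (Fin n) :=
  {x | ∃ κ ∈ cr p, x ∈ κ}

/-- The vector `ξ_p ∈ (ℂ^N)^{⊗k}`, identified with `(Fin k → Fin N) → ℂ`:
its coordinate at `i` is `1` if `i` is constant on every block of `p`, else `0`. -/
noncomputable def xi (N : ℕ) {k : ℕ} (p : Finpartition (Finset.univ : Finset (Fin k))) :
    (Fin k → Fin N) → ℂ :=
  fun i => if ∀ x y, PartRel p x y → i x = i y then 1 else 0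

/-- The span of the noncrossing-partition vectors `ξ_p`, `p ∈ NC(k)`. -/
noncomputable def ncSpan (N k : ℕ) : Submodule ℂ ((Fin k → Fin N) → ℂ) :=
  Submodule.span ℂ
    {v | ∃ p : Finpartition (Finset.univ : Finset (Fin k)), cr p = ∅ ∧ v = xi N p}

/-- The span of the crossing-partition vectors `ξ_p`, `p ∈ CR(k)`. -/
noncomputable def crSpan (N k : ℕ) : Submodule ℂ ((Fin k → Fin N) → ℂ) :=
  Submodule.span ℂ
    {v | ∃ p : Finpartition (Finset.univ : Finset (Fin k)), (cr p).Nonempty ∧ v = xi N p}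

/-- The span of all partition vectors `ξ_p`, `p ∈ P(k)`. -/
noncomputable def allSpan (N k : ℕ) : Submodule ℂ ((Fin k → Fin N) → ℂ) :=
  Submodule.span ℂ
    {v | ∃ p : Finpartition (Finset.univ : Finset (Fin k)), v = xi N p}

/-- Linear maps `(ℂ^N)^{⊗k} → (ℂ^N)^{⊗ℓ}`, as matrices with rows indexed by
lower index tuples and columns by upper index tuples. -/
abbrev Mat (N k ℓ : ℕ) := Matrix (Fin ℓ → Fin N) (Fin k → Fin N) ℂ

/-- The tensor product of two such linear maps. -/
def tensorMat {N k ℓ k' ℓ' : ℕ} (S : Mat N k ℓ) (T : Mat N k' ℓ') :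
    Mat N (k + k') (ℓ + ℓ') :=
  fun i j =>
    S (fun a => i (Fin.castAdd ℓ' a)) (fun b => j (Fin.castAdd k' b)) *
      T (fun a => i (Fin.natAdd ℓ a)) (fun b => j (Fin.natAdd k b))

/-- The cup: the map `(ℂ^N)^{⊗2} → ℂ` sending `e_i ⊗ e_j` to `δ_{ij}`. -/
def cupMat (N : ℕ) : Mat N 2 0 := fun _ j => if j 0 = j 1 then 1 else 0

/-- A Tannaka–Krein dual at parameter `N`: a family of subspaces
`C k ℓ ⊆ Hom((ℂ^N)^{⊗k}, (ℂ^N)^{⊗ℓ})` closed under tensor products, composition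
and adjoints, containing the identity of `ℂ^N` and the cup. -/
structure TKDual (N : ℕ) where
  C : ∀ k ℓ : ℕ, Submodule ℂ (Mat N k ℓ)
  tensor_mem : ∀ {k ℓ k' ℓ' : ℕ} {S : Mat N k ℓ} {T : Mat N k' ℓ'},
    S ∈ C k ℓ → T ∈ C k' ℓ' → tensorMat S T ∈ C (k + k') (ℓ + ℓ')
  comp_mem : ∀ {k ℓ r : ℕ} {S : Mat N ℓ r} {T : Mat N k ℓ},
    S ∈ C ℓ r → T ∈ C k ℓ → S * T ∈ C k r
  adj_mem : ∀ {k ℓ : ℕ} {T : Mat N k ℓ}, T ∈ C k ℓ → T.conjTranspose ∈ C ℓ k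
  id_mem : (1 : Matrix (Fin 1 → Fin N) (Fin 1 → Fin N) ℂ) ∈ C 1 1
  cup_mem : cupMat N ∈ C 2 0

/-- The involution of `Fin (k + ℓ)` fixing the first `k` (upper) points and
reversing the order of the last `ℓ` (lower) points. -/
def lowerRev (k ℓ : ℕ) : Fin (k + ℓ) → Fin (k + ℓ) :=
  Fin.append (fun a : Fin k => Fin.castAdd ℓ a) (fun a : Fin ℓ => Fin.natAdd k a.rev)

/-- A partition of `[k + ℓ]` (first `k` points upper, last `ℓ` points lower) is
noncrossing when the partition obtained by reversing the order of the lower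
points has no crossing. -/
def IsNCPart {k ℓ : ℕ} (p : Finpartition (Finset.univ : Finset (Fin (k + ℓ)))) : Prop :=
  ∀ κ, ¬ IsCross (fun x y => PartRel p (lowerRev k ℓ x) (lowerRev k ℓ y)) κ

/-- The linear map `T_p : (ℂ^N)^{⊗k} → (ℂ^N)^{⊗ℓ}` of a partition `p` of `[k + ℓ]`:
its entry at (lower tuple `i`, upper tuple `j`) is `1` if the labelling of the points
of `p` by `j` on the upper points and `i` on the lower points is constant on each
block of `p`, and `0` otherwise. -/
noncomputable def Tmat (N : ℕ) (k ℓ : ℕ)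
    (p : Finpartition (Finset.univ : Finset (Fin (k + ℓ)))) : Mat N k ℓ :=
  fun i j => if ∀ x y, PartRel p x y → Fin.append j i x = Fin.append j i y then 1 else 0

/-- The family `P(k,ℓ) = span{T_p : p a partition of [k+ℓ]}`. -/
noncomputable def Pfam (N k ℓ : ℕ) : Submodule ℂ (Mat N k ℓ) :=
  Submodule.span ℂ (Set.range (Tmat N k ℓ))

/-- The family `NC(k,ℓ) = span{T_p : p a noncrossing partition of [k+ℓ]}`. -/
noncomputable def NCfam (N k ℓ : ℕ) : Submodule ℂ (Mat N k ℓ) :=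
  Submodule.span ℂ {T | ∃ p, IsNCPart p ∧ T = Tmat N k ℓ p}

/-- A vector in `(ℂ^N)^{⊗k}` viewed as a linear map `(ℂ^N)^{⊗0} → (ℂ^N)^{⊗k}`. -/
def vecMat {N k : ℕ} (v : (Fin k → Fin N) → ℂ) : Mat N 0 k := fun i _ => v i

/-- `⟨NC, ξ⟩`: the smallest Tannaka–Krein dual containing all of `NC` together with
the vector `ξ ∈ (ℂ^N)^{⊗k}` (in degree `(0,k)`), i.e. the intersection of all such. -/
noncomputable def genNCxi (N : ℕ) {k : ℕ} (ξ : (Fin k → Fin N) → ℂ) (k' ℓ' : ℕ) :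
    Submodule ℂ (Mat N k' ℓ') :=
  ⨅ (C : TKDual N) (_ : ∀ a b, NCfam N a b ≤ C.C a b) (_ : vecMat ξ ∈ C.C 0 k),
    C.C k' ℓ'

lemma partRel_ofSetoid {n : ℕ} (s : Setoid (Fin n)) (x y : Fin n) :
    PartRel (Finpartition.ofSetoid s) x y ↔ s x y := by
  have key := Finpartition.mem_part_ofSetoid_iff_rel (s := s) (a := x) (b := y)
  rw [← key]
  constructor
  · rintro ⟨B, hB, hx, hy⟩
    rwa [Finpartition.part_eq_of_mem _ hB hx]
  · intro h
    exact ⟨_, (Finpartition.part_mem _).2 (Finset.mem_univ x),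
      Finpartition.mem_part _ (Finset.mem_univ x), h⟩

lemma partRel_iff_part {n : ℕ} (p : Finpartition (Finset.univ : Finset (Fin n))) (x y : Fin n) :
    PartRel p x y ↔ p.part x = p.part y := by
  constructor
  · rintro ⟨B, hB, hx, hy⟩
    rw [p.part_eq_of_mem hB hx, p.part_eq_of_mem hB hy]
  · intro h
    refine ⟨p.part x, (p.part_mem).2 (Finset.mem_univ x), p.mem_part (Finset.mem_univ x), ?_⟩
    rw [h]
    exact p.mem_part (Finset.mem_univ y)

/-- The map whose matrix entry at `(i, j)` is `1` if the labelling `F` of the upper and lower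
points identifies only points carrying equal indices, and `0` otherwise. -/
noncomputable def labelMat (N : ℕ) {k ℓ : ℕ} {β : Type*} (F : Fin (k + ℓ) → β) : Mat N k ℓ :=
  fun i j => if ∀ x y, F x = F y → Fin.append j i x = Fin.append j i y then 1 else 0

/-- The linear map sending the basis vector of the index tuple `j` to that of `j ∘ e`. -/
noncomputable def pullMat (N : ℕ) {k ℓ : ℕ} (e : Fin ℓ → Fin k) : Mat N k ℓ :=
  fun i j => if i = j ∘ e then 1 else 0

/-- The vector of the partition of `[n]` into the fibres of `F`. -/
noncomputable def labelVec (N : ℕ) {n : ℕ} {β : Type*} (F : Fin n → β) :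
    (Fin n → Fin N) → ℂ :=
  fun i => if ∀ x y, F x = F y → i x = i y then 1 else 0

/-- Every partition consists of the fibres of a surjective labelling. -/
lemma exists_label {n : ℕ} (p : Finpartition (Finset.univ : Finset (Fin n))) :
    ∃ (m : ℕ) (F : Fin n → Fin m), Function.Surjective F ∧
      ∀ x y, PartRel p x y ↔ F x = F y := by
  let s : Setoid (Fin n) := Setoid.ker p.part
  refine ⟨_, fun x => Finite.equivFin (Quotient s) (Quotient.mk s x), ?_, fun x y => ?_⟩
  · exact (Finite.equivFin (Quotient s)).surjective.comp Quotient.mk_surjective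
  · rw [partRel_iff_part, (Finite.equivFin (Quotient s)).injective.eq_iff, Quotient.eq]
    rfl

lemma Tmat_eq_labelMat {N k ℓ : ℕ} {β : Type*}
    {p : Finpartition (Finset.univ : Finset (Fin (k + ℓ)))}
    {F : Fin (k + ℓ) → β} (h : ∀ x y, PartRel p x y ↔ F x = F y) :
    Tmat N k ℓ p = labelMat N F := by
  funext i j
  simp only [Tmat, labelMat, h]

lemma forall_fin_add_iff {k ℓ : ℕ} {P : Fin (k + ℓ) → Prop} :
    (∀ x, P x) ↔ (∀ a : Fin k, P (Fin.castAdd ℓ a)) ∧ ∀ b : Fin ℓ, P (Fin.natAdd k b) :=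
  ⟨fun h => ⟨fun _ => h _, fun _ => h _⟩, fun h x => Fin.addCases h.1 h.2 x⟩

lemma labelMat_append {N k ℓ : ℕ} {β : Type*} (u : Fin k → β) (l : Fin ℓ → β)
    (i : Fin ℓ → Fin N) (j : Fin k → Fin N) :
    labelMat N (Fin.append u l) i j =
      if (∀ x y, u x = u y → j x = j y) ∧ (∀ x y, l x = l y → i x = i y) ∧
        (∀ x y, u x = l y → j x = i y) then 1 else 0 := by
  unfold labelMat
  congr 1
  simp only [forall_fin_add_iff, Fin.append_left, Fin.append_right, eq_iff_iff]
  constructor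
  · rintro ⟨h1, h2⟩
    exact ⟨fun x y => (h1 x).1 y, fun x y => (h2 x).2 y, fun x y => (h1 x).2 y⟩
  · rintro ⟨h1, h2, h3⟩
    exact ⟨fun x => ⟨h1 x, h3 x⟩, fun x => ⟨fun y h => (h3 y x h.symm).symm, h2 x⟩⟩

lemma append_comp_lowerRev {k ℓ : ℕ} {β : Type*} (u : Fin k → β) (l : Fin ℓ → β)
    (x : Fin (k + ℓ)) :
    Fin.append u l (lowerRev k ℓ x) = Fin.append u (l ∘ Fin.rev) x := by
  refine Fin.addCases (fun a => ?_) (fun a => ?_) x <;> simp [lowerRev]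

lemma labelMat_mem_NCfam {N k ℓ : ℕ} {β : Type*} (u : Fin k → β) (l : Fin ℓ → β)
    (h : ∀ a b c d : Fin (k + ℓ), a < b → b < c → c < d →
      Fin.append u (l ∘ Fin.rev) a = Fin.append u (l ∘ Fin.rev) c →
      Fin.append u (l ∘ Fin.rev) b = Fin.append u (l ∘ Fin.rev) d →
      Fin.append u (l ∘ Fin.rev) a = Fin.append u (l ∘ Fin.rev) b) :
    labelMat N (Fin.append u l) ∈ NCfam N k ℓ := by
  have hrel : ∀ x y, PartRel (Finpartition.ofSetoid (Setoid.ker (Fin.append u l))) x y ↔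
      Fin.append u l x = Fin.append u l y := fun x y => by
    rw [partRel_ofSetoid]; rfl
  refine Submodule.subset_span ⟨_, ?_, (Tmat_eq_labelMat hrel).symm⟩
  rintro κ ⟨a, b, c, d, hab, hbc, hcd, -, hac, hbd, hn⟩
  simp only [hrel, append_comp_lowerRev] at hac hbd hn
  exact hn (h a b c d hab hbc hcd hac hbd)

lemma min_le_append_rev {k ℓ : ℕ} {β : Type*} [LinearOrder β] {u : Fin k → β} {l : Fin ℓ → β}
    (hu : Monotone u) (hl : Monotone l) {a b c : Fin (k + ℓ)} (hab : a < b) (hbc : b < c) :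
    min (Fin.append u (l ∘ Fin.rev) a) (Fin.append u (l ∘ Fin.rev) c) ≤
      Fin.append u (l ∘ Fin.rev) b := by
  induction b using Fin.addCases with
  | left b =>
    induction a using Fin.addCases with
    | left a =>
      rw [Fin.append_left, Fin.append_left]
      exact min_le_of_left_le (hu (Fin.le_def.2 (Fin.le_def.1 hab.le)))
    | right a => simp [Fin.lt_def] at hab; omega
  | right b =>
    induction c using Fin.addCases with
    | left c => simp [Fin.lt_def] at hbc; omega
    | right c =>
      rw [Fin.append_right, Fin.append_right]
      refine min_le_of_right_le (hl (Fin.rev_le_rev.2 ?_))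
      have := Fin.le_def.1 hbc.le
      simp only [Fin.val_natAdd] at this
      exact Fin.le_def.2 (by omega)

lemma labelMat_mem_NCfam_of_monotone {N k ℓ : ℕ} {β : Type*} [LinearOrder β]
    {u : Fin k → β} {l : Fin ℓ → β} (hu : Monotone u) (hl : Monotone l) :
    labelMat N (Fin.append u l) ∈ NCfam N k ℓ := by
  refine labelMat_mem_NCfam u l fun a b c d hab hbc hcd hac hbd => ?_
  have h1 := min_le_append_rev hu hl hab hbc
  have h2 := min_le_append_rev hu hl hbc hcd
  rw [← hac, min_self] at h1
  rw [← hbd, min_self, ← hac] at h2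
  exact le_antisymm h1 h2

lemma pullMat_eq_labelMat (N : ℕ) {k ℓ : ℕ} (e : Fin ℓ → Fin k) :
    pullMat N e = labelMat N (Fin.append id e) := by
  funext i j
  rw [labelMat_append]
  unfold pullMat
  congr 1
  simp only [id, eq_iff_iff]
  constructor
  · rintro rfl
    refine ⟨fun x y h => by rw [h], fun x y h => ?_, fun x y h => by rw [h]; rfl⟩
    simp [h]
  · rintro ⟨-, -, h⟩
    funext t
    exact (h _ t rfl).symm

lemma pullMat_mem_NCfam {N k ℓ : ℕ} {e : Fin ℓ → Fin k} (he : Monotone e) :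
    pullMat N e ∈ NCfam N k ℓ := by
  rw [pullMat_eq_labelMat]
  exact labelMat_mem_NCfam_of_monotone monotone_id he

lemma mul_pullMat {N k ℓ r : ℕ} (L : Mat N ℓ r) (e : Fin ℓ → Fin k) (i : Fin r → Fin N)
    (j : Fin k → Fin N) : (L * pullMat N e) i j = L i (j ∘ e) := by
  simp [Matrix.mul_apply, pullMat]

lemma pullMat_mul_pullMat (N : ℕ) {k ℓ r : ℕ} (e : Fin r → Fin ℓ) (e' : Fin ℓ → Fin k) :
    pullMat N e * pullMat N e' = pullMat N (e' ∘ e) := by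
  funext i j
  rw [mul_pullMat]
  rfl

lemma pullMat_perm_mul {N k ℓ : ℕ} (τ : Equiv.Perm (Fin ℓ)) (L : Mat N k ℓ)
    (i : Fin ℓ → Fin N) (j : Fin k → Fin N) :
    (pullMat N (τ⁻¹ : Equiv.Perm (Fin ℓ)) * L) i j = L (i ∘ τ) j := by
  have h : ∀ w : Fin ℓ → Fin N, i = w ∘ (τ⁻¹ : Equiv.Perm (Fin ℓ)) ↔ i ∘ τ = w := by
    intro w
    constructor
    · rintro rfl
      funext x
      simp
    · rintro rfl
      funext x
      simp
  simp only [Matrix.mul_apply, pullMat, h, ite_mul, one_mul, zero_mul, Finset.sum_ite_eq,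
    Finset.mem_univ, if_true]

/-! ### Partition maps are the invariants of the symmetric group -/

lemma exists_perm_comp_eq {N n : ℕ} {s t : Fin n → Fin N} (h : Setoid.ker s = Setoid.ker t) :
    ∃ π : Equiv.Perm (Fin N), π ∘ s = t := by
  let e : {x // x ∈ Set.range s} ≃ {x // x ∈ Set.range t} :=
    (Setoid.quotientKerEquivRange s).symm.trans
      ((Quotient.congrRight (fun x y => by
        show Setoid.ker s x y ↔ Setoid.ker t x y
        rw [h])).trans (Setoid.quotientKerEquivRange t))
  refine ⟨e.extendSubtype, funext fun x => ?_⟩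
  rw [Function.comp_apply, Equiv.extendSubtype_apply_of_mem e _ ⟨x, rfl⟩]
  have hx : (Setoid.quotientKerEquivRange s).symm ⟨s x, x, rfl⟩ = Quotient.mk _ x := by
    rw [Equiv.symm_apply_eq]
    rfl
  simp only [e, Equiv.trans_apply, hx]
  rfl

/-- The Tannaka–Krein dual of maps commuting with the permutations of the basis of `ℂ^N`. -/
def invDual (N : ℕ) : TKDual N where
  C k ℓ :=
    { carrier := {M | ∀ (π : Equiv.Perm (Fin N)) i j, M (π ∘ i) (π ∘ j) = M i j}
      add_mem' := fun hS hT π i j => by simp only [Matrix.add_apply, hS π i j, hT π i j]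
      zero_mem' := fun π i j => rfl
      smul_mem' := fun c T hT π i j => by simp only [Matrix.smul_apply, hT π i j] }
  tensor_mem := fun hS hT π i j => congrArg₂ (· * ·) (hS π _ _) (hT π _ _)
  comp_mem := fun {k ℓ r S T} hS hT π i j => by
    rw [Matrix.mul_apply, Matrix.mul_apply,
      ← Equiv.sum_comp (Equiv.arrowCongr (Equiv.refl (Fin ℓ)) π)]
    exact Finset.sum_congr rfl fun w _ => congrArg₂ (· * ·) (hS π i w) (hT π w j)
  adj_mem := fun hT π i j => congrArg star (hT π j i)
  id_mem := fun π i j => by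
    simp only [Matrix.one_apply, π.injective.comp_left.eq_iff]
  cup_mem := fun π i j => by
    simp only [cupMat, Function.comp_apply, π.injective.eq_iff]

lemma append_comp {N k ℓ : ℕ} (π : Fin N → Fin N) (j : Fin k → Fin N) (i : Fin ℓ → Fin N) :
    Fin.append (π ∘ j) (π ∘ i) = π ∘ Fin.append j i := by
  funext x
  refine Fin.addCases (fun a => ?_) (fun a => ?_) x <;> simp

lemma Pfam_le_invDual (N k ℓ : ℕ) : Pfam N k ℓ ≤ (invDual N).C k ℓ := by
  refine Submodule.span_le.2 ?_
  rintro _ ⟨p, rfl⟩ π i j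
  simp only [Tmat, append_comp, Function.comp_apply, π.injective.eq_iff]

lemma NCfam_le_Pfam (N k ℓ : ℕ) : NCfam N k ℓ ≤ Pfam N k ℓ := by
  refine Submodule.span_mono ?_
  rintro _ ⟨p, -, rfl⟩
  exact ⟨p, rfl⟩

/-- The indicator of the index tuples whose kernel is `s`. -/
noncomputable def kerMat (N k ℓ : ℕ) (s : Setoid (Fin (k + ℓ))) : Mat N k ℓ :=
  fun i j => if Setoid.ker (Fin.append j i) = s then 1 else 0

noncomputable instance fintypeSetoidFin (n : ℕ) : Fintype (Setoid (Fin n)) :=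
  Fintype.ofInjective (fun s : Setoid (Fin n) => (s : Fin n → Fin n → Prop))
    fun _ _ h => Setoid.ext fun a b => iff_of_eq (congrFun (congrFun h a) b)

lemma Tmat_ofSetoid_eq_sum (N k ℓ : ℕ) (s : Setoid (Fin (k + ℓ))) :
    Tmat N k ℓ (Finpartition.ofSetoid s) =
      ∑ t ∈ Finset.univ.filter (s ≤ ·), kerMat N k ℓ t := by
  ext i j
  rw [Matrix.sum_apply]
  simp only [kerMat, Finset.sum_ite_eq, Finset.mem_filter, Finset.mem_univ, true_and, Tmat,
    partRel_ofSetoid]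
  congr 1

lemma kerMat_mem_Pfam (N k ℓ : ℕ) (s : Setoid (Fin (k + ℓ))) :
    kerMat N k ℓ s ∈ Pfam N k ℓ := by
  induction s using WellFoundedGT.induction with
  | ind s ih =>
    have h := Tmat_ofSetoid_eq_sum N k ℓ s
    rw [← Finset.add_sum_erase _ _ (a := s) (by simp)] at h
    rw [eq_sub_of_add_eq h.symm]
    refine Submodule.sub_mem _ (Submodule.subset_span ⟨_, rfl⟩) (Submodule.sum_mem _ ?_)
    intro t ht
    rw [Finset.mem_erase, Finset.mem_filter] at ht
    exact ih t (lt_of_le_of_ne ht.2.2 ht.1.symm)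

lemma invDual_le_Pfam (N k ℓ : ℕ) : (invDual N).C k ℓ ≤ Pfam N k ℓ := by
  intro M hM
  have hex : ∃ c : Setoid (Fin (k + ℓ)) → ℂ,
      ∀ i j, M i j = c (Setoid.ker (Fin.append j i)) := by
    refine ⟨fun s => if h : ∃ w : (Fin ℓ → Fin N) × (Fin k → Fin N),
      Setoid.ker (Fin.append w.2 w.1) = s then M h.choose.1 h.choose.2 else 0, fun i j => ?_⟩
    have h : ∃ w : (Fin ℓ → Fin N) × (Fin k → Fin N),
      Setoid.ker (Fin.append w.2 w.1) = Setoid.ker (Fin.append j i) := ⟨(i, j), rfl⟩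
    simp only [dif_pos h]
    obtain ⟨π, hπ⟩ := exists_perm_comp_eq h.choose_spec
    rw [← append_comp] at hπ
    have hj : π ∘ h.choose.2 = j := funext fun x => by
      simpa using congrFun hπ (Fin.castAdd ℓ x)
    have hi : π ∘ h.choose.1 = i := funext fun x => by
      simpa using congrFun hπ (Fin.natAdd k x)
    rw [← hM π h.choose.1 h.choose.2, hi, hj]
  obtain ⟨c, hc⟩ := hex
  have hsum : M = ∑ s, c s • kerMat N k ℓ s := by
    ext i j
    rw [Matrix.sum_apply, hc i j]
    simp [kerMat]
  rw [hsum]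
  exact Submodule.sum_mem _ fun s _ => Submodule.smul_mem _ _ (kerMat_mem_Pfam N k ℓ s)

lemma vecMat_xi_mem_invDual (N : ℕ) {k : ℕ} (p : Finpartition (Finset.univ : Finset (Fin k))) :
    vecMat (xi N p) ∈ (invDual N).C 0 k := fun π i j => by
  simp only [vecMat, xi, Function.comp_apply, π.injective.eq_iff]

/-! ### A Tannaka–Krein dual containing the basic crossing contains all partitions -/

lemma labelVec_cross_apply {N : ℕ} (i : Fin 4 → Fin N) :
    labelVec N ![0, 1, 0, 1] i = if i 0 = i 2 ∧ i 1 = i 3 then 1 else 0 := by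
  unfold labelVec
  congr 1
  rw [eq_iff_iff]
  constructor
  · intro h
    exact ⟨h 0 2 rfl, h 1 3 rfl⟩
  · rintro ⟨h1, h2⟩ x y hxy
    fin_cases x <;> fin_cases y <;> simp_all

/-- The planar map contracting the two upper points of `[2]` with the first two points of a
vector in `(ℂ^N)^{⊗4}`, in nested order. -/
lemma contraction_mem_NCfam (N : ℕ) :
    labelMat N (Fin.append ![0, 1, 1, 0, 2, 3] ![2, 3] : Fin (6 + 2) → ℕ) ∈ NCfam N 6 2 := by
  refine labelMat_mem_NCfam _ _ ?_
  decide

lemma swap_mem {N : ℕ} (C : TKDual N) (hC : ∀ a b, NCfam N a b ≤ C.C a b)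
    (hX : vecMat (labelVec N ![0, 1, 0, 1]) ∈ C.C 0 4) :
    pullMat N (Equiv.swap (0 : Fin 2) 1) ∈ C.C 2 2 := by
  have h2 : pullMat N (id : Fin 2 → Fin 2) ∈ C.C 2 2 := hC _ _ (pullMat_mem_NCfam monotone_id)
  have h := C.comp_mem (hC _ _ (contraction_mem_NCfam N)) (C.tensor_mem h2 hX)
  convert h using 1
  funext i j
  let w₀ : Fin 6 → Fin N := ![j 0, j 1, j 1, j 0, i 0, i 1]
  have hL : ∀ w : Fin 6 → Fin N,
      labelMat N (Fin.append ![0, 1, 1, 0, 2, 3] ![2, 3] : Fin (6 + 2) → ℕ) i w =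
        if w 0 = w 3 ∧ w 1 = w 2 ∧ w 4 = i 0 ∧ w 5 = i 1 then 1 else 0 := by
    intro w
    rw [labelMat_append]
    congr 1
    rw [eq_iff_iff]
    constructor
    · rintro ⟨h1, -, h3⟩
      exact ⟨h1 0 3 rfl, h1 1 2 rfl, h3 4 0 rfl, h3 5 1 rfl⟩
    · rintro ⟨h1, h2, h3, h4⟩
      refine ⟨fun x y hxy => ?_, fun x y hxy => ?_, fun x y hxy => ?_⟩ <;>
        fin_cases x <;> fin_cases y <;> simp_all
  have hR : ∀ w : Fin 6 → Fin N,
      tensorMat (pullMat N (id : Fin 2 → Fin 2)) (vecMat (labelVec N ![0, 1, 0, 1])) w j =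
        if (w 0 = j 0 ∧ w 1 = j 1) ∧ w 2 = w 4 ∧ w 3 = w 5 then 1 else 0 := by
    intro w
    have hj : (∀ x : Fin 2, w (Fin.castAdd 4 x) = j (Fin.castAdd 0 x)) ↔
        w 0 = j 0 ∧ w 1 = j 1 := by
      rw [Fin.forall_fin_two]
      rfl
    have hv : labelVec N ![0, 1, 0, 1] (fun a : Fin 4 => w (Fin.natAdd 2 a)) =
        if w 2 = w 4 ∧ w 3 = w 5 then 1 else 0 := labelVec_cross_apply _
    have hp : pullMat N (id : Fin 2 → Fin 2) (fun a => w (Fin.castAdd 4 a))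
        (fun b => j (Fin.castAdd 0 b)) = if w 0 = j 0 ∧ w 1 = j 1 then 1 else 0 := by
      unfold pullMat
      congr 1
      rw [funext_iff, eq_iff_iff]
      exact hj
    simp only [tensorMat, vecMat]
    rw [hp, hv]
    split_ifs <;> simp_all
  have hS : pullMat N (Equiv.swap (0 : Fin 2) 1) i j =
      if i 0 = j 1 ∧ i 1 = j 0 then 1 else 0 := by
    unfold pullMat
    congr 1
    simp [funext_iff, Fin.forall_fin_two]
  rw [hS, Matrix.mul_apply]
  refine Eq.trans ?_ (Finset.sum_congr rfl fun w _ => congrArg₂ (· * ·) (hL w) (hR w)).symm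
  rw [Finset.sum_eq_single w₀]
  · simp [w₀, eq_comm]
  · intro w _ hw
    refine mul_eq_zero.2 (or_iff_not_imp_left.2 fun h1 => if_neg fun h2 => hw ?_)
    have h1 := (ite_ne_right_iff.1 h1).1
    funext x
    fin_cases x <;> simp_all [w₀]
  · simp

lemma tensorMat_pullMat (N : ℕ) {k ℓ k' ℓ' : ℕ} (e : Fin ℓ → Fin k) (e' : Fin ℓ' → Fin k') :
    tensorMat (pullMat N e) (pullMat N e') =
      pullMat N (Fin.append (Fin.castAdd k' ∘ e) (Fin.natAdd k ∘ e')) := by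
  funext i j
  simp only [tensorMat, pullMat, funext_iff,
    forall_fin_add_iff, Fin.append_left, Fin.append_right, Function.comp_apply]
  split_ifs <;> simp_all

lemma adjacent_swap_mem {N : ℕ} (C : TKDual N) (hC : ∀ a b, NCfam N a b ≤ C.C a b)
    (hs : pullMat N (Equiv.swap (0 : Fin 2) 1) ∈ C.C 2 2) {M a b : ℕ} (hM : M = a + 2 + b)
    (x y : Fin M) (hx : (x : ℕ) = a) (hy : (y : ℕ) = a + 1) :
    pullMat N (Equiv.swap x y) ∈ C.C M M := by
  subst hM
  have hid : ∀ n, pullMat N (id : Fin n → Fin n) ∈ C.C n n :=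
    fun n => hC _ _ (pullMat_mem_NCfam monotone_id)
  have h := C.tensor_mem (C.tensor_mem (hid a) hs) (hid b)
  rw [tensorMat_pullMat, tensorMat_pullMat] at h
  convert h using 2
  obtain rfl : x = Fin.castAdd b (Fin.natAdd a 0) := Fin.ext (by simpa using hx)
  obtain rfl : y = Fin.castAdd b (Fin.natAdd a 1) := Fin.ext (by simpa using hy)
  funext z
  induction z using Fin.addCases with
  | left z =>
    induction z using Fin.addCases with
    | left z =>
      rw [Equiv.swap_apply_of_ne_of_ne] <;> simp [Fin.ext_iff] <;> omega
    | right z => fin_cases z <;> simp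
  | right z =>
    rw [Equiv.swap_apply_of_ne_of_ne] <;> simp [Fin.ext_iff] <;> omega

lemma perm_mem {N : ℕ} (C : TKDual N) (hC : ∀ a b, NCfam N a b ≤ C.C a b)
    (hs : pullMat N (Equiv.swap (0 : Fin 2) 1) ∈ C.C 2 2) :
    ∀ {n : ℕ} (σ : Equiv.Perm (Fin n)), pullMat N σ ∈ C.C n n
  | 0, σ => by
    rw [Subsingleton.elim σ 1]
    exact hC _ _ (pullMat_mem_NCfam monotone_id)
  | n + 1, σ => by
    have hσ : σ ∈ Submonoid.closure
        (Set.range fun i : Fin n => Equiv.swap i.castSucc i.succ) := by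
      rw [Equiv.Perm.mclosure_swap_castSucc_succ]
      trivial
    induction hσ using Submonoid.closure_induction with
    | mem σ hσ =>
      obtain ⟨i, rfl⟩ := hσ
      exact adjacent_swap_mem C hC hs (a := i) (b := n - 1 - i) (by omega) _ _
        (by simp) (by simp)
    | one => exact hC _ _ (pullMat_mem_NCfam monotone_id)
    | mul σ τ _ _ h1 h2 =>
      have h := C.comp_mem h2 h1
      rwa [pullMat_mul_pullMat] at h

lemma Pfam_le_of_cross_mem {N : ℕ} (C : TKDual N) (hC : ∀ a b, NCfam N a b ≤ C.C a b)
    (hX : vecMat (labelVec N ![0, 1, 0, 1]) ∈ C.C 0 4) (k ℓ : ℕ) :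
    Pfam N k ℓ ≤ C.C k ℓ := by
  have hperm := @perm_mem N C hC (swap_mem C hC hX)
  refine Submodule.span_le.2 ?_
  rintro _ ⟨p, rfl⟩
  obtain ⟨m, F, -, hF⟩ := exists_label p
  obtain ⟨u, l, rfl⟩ : ∃ u l, F = Fin.append u l :=
    ⟨_, _, (Fin.append_castAdd_natAdd (f := F)).symm⟩
  have h := C.comp_mem (C.comp_mem (hperm (Tuple.sort l)⁻¹)
    (hC _ _ (labelMat_mem_NCfam_of_monotone (Tuple.monotone_sort u) (Tuple.monotone_sort l))))
    (hperm (Tuple.sort u))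
  rw [SetLike.mem_coe, Tmat_eq_labelMat hF]
  convert h using 1
  funext i j
  rw [mul_pullMat, pullMat_perm_mul, labelMat_append, labelMat_append]
  congr 1
  simp only [Function.comp_apply, eq_iff_iff]
  refine and_congr ?_ (and_congr ?_ ?_)
  · rw [← (Tuple.sort u).forall_congr_right]
    exact forall_congr' fun x => (Tuple.sort u).forall_congr_right.symm
  · rw [← (Tuple.sort l).forall_congr_right]
    exact forall_congr' fun x => (Tuple.sort l).forall_congr_right.symm
  · rw [← (Tuple.sort u).forall_congr_right]
    exact forall_congr' fun x => (Tuple.sort l).forall_congr_right.symm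

/-! ### Restricting a partition to four points -/

lemma mem_cr_iff {k : ℕ} (p : Finpartition (Finset.univ : Finset (Fin k))) {κ : Finset (Fin k)}
    (hκ : κ.card = 4) :
    κ ∈ cr p ↔ PartRel p (κ.orderEmbOfFin hκ 0) (κ.orderEmbOfFin hκ 2) ∧
      PartRel p (κ.orderEmbOfFin hκ 1) (κ.orderEmbOfFin hκ 3) ∧
      ¬ PartRel p (κ.orderEmbOfFin hκ 0) (κ.orderEmbOfFin hκ 1) := by
  constructor
  · rintro ⟨a, b, c, d, hab, hbc, hcd, hκ', h⟩
    have he : ![a, b, c, d] = κ.orderEmbOfFin hκ := by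
      refine Finset.orderEmbOfFin_unique hκ (fun x => ?_) ?_
      · rw [hκ']
        fin_cases x <;> simp
      · rw [Fin.strictMono_iff_lt_succ]
        intro x
        fin_cases x <;> simp [hab, hbc, hcd]
    rw [← he]
    simpa using h
  · intro h
    refine ⟨_, _, _, _, ?_, ?_, ?_, ?_, h⟩
    · simp
    · simp
    · simp
    · ext x
      have hx := Set.ext_iff.1 (Finset.range_orderEmbOfFin κ hκ) x
      rw [Finset.mem_coe] at hx
      rw [← hx, Set.mem_range, Fin.exists_fin_succ, Fin.exists_fin_succ, Fin.exists_fin_succ,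
        Fin.exists_fin_succ]
      simp [eq_comm]

lemma pullMat_mul_vecMat_xi {N k n m : ℕ} [NeZero N]
    {p : Finpartition (Finset.univ : Finset (Fin k))}
    {F : Fin k → Fin m} (hF : Function.Surjective F)
    (hp : ∀ x y, PartRel p x y ↔ F x = F y) (e : Fin n → Fin k) :
    pullMat N e * vecMat (xi N p) =
      ((N : ℂ) ^ (m - (Finset.univ.image (F ∘ e)).card)) • vecMat (labelVec N (F ∘ e)) := by
  funext i j
  have hL : (pullMat N e * vecMat (xi N p)) i j =
      ((Finset.univ.filter fun w : Fin k → Fin N =>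
        i = w ∘ e ∧ ∀ x y, F x = F y → w x = w y).card : ℂ) := by
    rw [Matrix.mul_apply, Finset.card_filter, Nat.cast_sum]
    refine Finset.sum_congr rfl fun w _ => ?_
    simp only [pullMat, vecMat, xi, hp]
    by_cases h1 : i = w ∘ e <;> by_cases h2 : ∀ x y, F x = F y → w x = w y
    · rw [if_pos h1, if_pos h2, if_pos ⟨h1, h2⟩, mul_one, Nat.cast_one]
    · rw [if_neg h2, mul_zero, if_neg (not_and_of_not_right _ h2), Nat.cast_zero]
    · rw [if_neg h1, zero_mul, if_neg (not_and_of_not_left _ h1), Nat.cast_zero]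
    · rw [if_neg h1, zero_mul, if_neg (not_and_of_not_left _ h1), Nat.cast_zero]
  rw [hL, Matrix.smul_apply, vecMat, labelVec]
  split_ifs with hi
  · have hfac : Function.FactorsThrough i (F ∘ e) := fun x y h => hi x y h
    let A : Fin m → Finset (Fin N) := fun q =>
      if q ∈ Finset.univ.image (F ∘ e) then {Function.extend (F ∘ e) i 0 q} else Finset.univ
    have hcard : (Fintype.piFinset A).card =
        N ^ (m - (Finset.univ.image (F ∘ e)).card) := by
      have h1 : ∀ q, (A q).card =
          if q ∈ Finset.univ.image (F ∘ e) then 1 else N := fun q => by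
        simp only [A]
        split_ifs <;> simp
      rw [Fintype.card_piFinset, Finset.prod_congr rfl fun q _ => h1 q, Finset.prod_ite,
        Finset.prod_const_one, one_mul, Finset.prod_const]
      congr 1
      rw [Finset.filter_not, Finset.filter_mem_eq_inter, Finset.univ_inter,
        ← Finset.compl_eq_univ_sdiff, Finset.card_compl, Fintype.card_fin]
    rw [smul_eq_mul, mul_one, ← Nat.cast_pow, ← hcard, Nat.cast_inj]
    symm
    refine Finset.card_bij (fun g _ => g ∘ F) ?_ ?_ ?_
    · intro g hg
      rw [Finset.mem_filter]
      refine ⟨Finset.mem_univ _, funext fun t => ?_, fun x y h => by simp [h]⟩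
      have := Fintype.mem_piFinset.1 hg (F (e t))
      have hmem : F (e t) ∈ Finset.univ.image (F ∘ e) :=
        Finset.mem_image_of_mem (F ∘ e) (Finset.mem_univ t)
      simp only [A, if_pos hmem, Finset.mem_singleton] at this
      rw [Function.comp_apply, Function.comp_apply, this]
      exact (hfac.extend_apply 0 t).symm
    · intro g _ g' _ h
      exact hF.injective_comp_right h
    · intro w hw
      obtain ⟨-, hiw, hw⟩ := Finset.mem_filter.1 hw
      obtain ⟨f', hf'⟩ := hF.hasRightInverse
      have hwF : (w ∘ f') ∘ F = w := funext fun x => hw _ _ (hf' (F x))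
      refine ⟨w ∘ f', Fintype.mem_piFinset.2 fun q => ?_, hwF⟩
      by_cases hq : q ∈ Finset.univ.image (F ∘ e)
      · obtain ⟨t, -, rfl⟩ := Finset.mem_image.1 hq
        simp only [A, if_pos hq, Finset.mem_singleton]
        rw [hfac.extend_apply 0 t, hiw]
        exact congrFun hwF (e t)
      · simp only [A, if_neg hq, Finset.mem_univ]
  · rw [smul_zero, Nat.cast_eq_zero, Finset.card_eq_zero, Finset.filter_eq_empty_iff]
    rintro w - ⟨rfl, hw⟩
    exact hi fun x y h => hw _ _ h

lemma labelVec_mem_NCfam {N : ℕ} {β : Type*} {F : Fin 4 → β}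
    (hF : ¬ (F 0 = F 2 ∧ F 1 = F 3 ∧ F 0 ≠ F 1)) : vecMat (labelVec N F) ∈ NCfam N 0 4 := by
  have h : labelMat N (Fin.append (Fin.elim0 : Fin 0 → β) F) ∈ NCfam N 0 4 := by
    refine labelMat_mem_NCfam _ _ fun a b c d hab hbc hcd hac hbd => ?_
    have ha : a = Fin.natAdd 0 (0 : Fin 4) := Fin.ext (by simp; omega)
    have hb : b = Fin.natAdd 0 (1 : Fin 4) := Fin.ext (by simp; omega)
    have hc : c = Fin.natAdd 0 (2 : Fin 4) := Fin.ext (by simp; omega)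
    have hd : d = Fin.natAdd 0 (3 : Fin 4) := Fin.ext (by simp; omega)
    subst ha hb hc hd
    simp only [Fin.append_right, Function.comp_apply] at hac hbd ⊢
    change F 3 = F 1 at hac
    change F 2 = F 0 at hbd
    change F 3 = F 2
    by_contra hne
    exact hF ⟨hbd.symm, hac.symm, fun h => hne (by rw [hac, hbd, h])⟩
  convert h using 1
  funext i j
  rw [labelMat_append]
  simp [vecMat, labelVec]

lemma pullMat_mul_vecMat_xi_of_mem_cr {N k m : ℕ} [NeZero N]
    {p : Finpartition (Finset.univ : Finset (Fin k))}
    {F : Fin k → Fin m} (hF : Function.Surjective F)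
    (hp : ∀ x y, PartRel p x y ↔ F x = F y) {κ : Finset (Fin k)} (hκ : κ.card = 4)
    (hcr : κ ∈ cr p) :
    pullMat N (κ.orderEmbOfFin hκ) * vecMat (xi N p) =
      ((N : ℂ) ^ (m - 2)) • vecMat (labelVec N ![0, 1, 0, 1]) := by
  rw [pullMat_mul_vecMat_xi hF hp]
  rw [mem_cr_iff p hκ, hp, hp, hp] at hcr
  obtain ⟨h02, h13, h01⟩ := hcr
  have himg : Finset.univ.image (F ∘ κ.orderEmbOfFin hκ) =
      {F (κ.orderEmbOfFin hκ 0), F (κ.orderEmbOfFin hκ 1)} := by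
    ext q
    rw [Finset.mem_image]
    simp only [Finset.mem_univ, true_and, Function.comp_apply, Finset.mem_insert,
      Finset.mem_singleton]
    constructor
    · rintro ⟨t, rfl⟩
      fin_cases t
      · exact Or.inl rfl
      · exact Or.inr rfl
      · exact Or.inl h02.symm
      · exact Or.inr h13.symm
    · rintro (rfl | rfl)
      · exact ⟨0, rfl⟩
      · exact ⟨1, rfl⟩
  rw [himg, Finset.card_pair h01]
  congr 2
  funext i
  rw [labelVec_cross_apply]
  unfold labelVec
  congr 1
  rw [eq_iff_iff]
  constructor
  · intro h
    exact ⟨h 0 2 h02, h 1 3 h13⟩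
  · rintro ⟨h1, h2⟩ x y hxy
    fin_cases x <;> fin_cases y <;> simp_all

lemma exists_sum_ne_zero_of_span_eq_top {ι : Type*} {m : ℕ} {s : Set ι} {v : ι → Fin m → ℂ}
    (hspan : Submodule.span ℂ {w | ∃ κ, κ ∈ s ∧ w = v κ} = ⊤)
    {b : Fin m → ℂ} (hb : b ≠ 0) : ∃ κ ∈ s, ∑ j, b j * v κ j ≠ 0 := by
  by_contra! h
  apply hb
  have hle : Submodule.span ℂ {w | ∃ κ, κ ∈ s ∧ w = v κ} ≤
      LinearMap.ker (Fintype.linearCombination ℂ b) := by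
    refine Submodule.span_le.2 ?_
    rintro _ ⟨κ, hκ, rfl⟩
    have := h κ hκ
    simpa [Fintype.linearCombination_apply, mul_comm] using this
  funext j
  have hj : Pi.single j (1 : ℂ) ∈ LinearMap.ker (Fintype.linearCombination ℂ b) :=
    hle (hspan ▸ Submodule.mem_top)
  simpa using hj

lemma cross_mem {N k m : ℕ} (hN : N ≠ 0)
    (p : Fin m → Finpartition (Finset.univ : Finset (Fin k))) (α : Fin m → ℂ) (hα : α ≠ 0)
    (hspan : Submodule.span ℂ
      {v : Fin m → ℂ | ∃ κ : Finset (Fin k), κ.card = 4 ∧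
        v = fun j => if κ ∈ cr (p j) then (1 : ℂ) else 0} = ⊤)
    (C : TKDual N) (hC : ∀ a b, NCfam N a b ≤ C.C a b)
    (hξ : vecMat (∑ i, α i • xi N (p i)) ∈ C.C 0 k) :
    vecMat (labelVec N ![0, 1, 0, 1]) ∈ C.C 0 4 := by
  have : NeZero N := ⟨hN⟩
  have hN' : (N : ℂ) ≠ 0 := Nat.cast_ne_zero.2 hN
  choose n F hFs hF using fun j => exists_label (p j)
  have hb : (fun j => α j * (N : ℂ) ^ (n j - 2)) ≠ 0 := by
    obtain ⟨j, hj⟩ := Function.ne_iff.1 hα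
    exact Function.ne_iff.2 ⟨j, mul_ne_zero hj (pow_ne_zero _ hN')⟩
  obtain ⟨κ, hκ, hne⟩ := exists_sum_ne_zero_of_span_eq_top
    (s := {κ : Finset (Fin k) | κ.card = 4})
    (v := fun κ j => if κ ∈ cr (p j) then (1 : ℂ) else 0) hspan hb
  have hκ' : κ.card = 4 := hκ
  set e := κ.orderEmbOfFin hκ'
  have h := C.comp_mem (hC _ _ (pullMat_mem_NCfam (N := N) e.monotone)) hξ
  have hexp : pullMat N e * vecMat (∑ i, α i • xi N (p i)) =
      ∑ j, α j • (pullMat N e * vecMat (xi N (p j))) := by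
    have : vecMat (∑ i, α i • xi N (p i)) = ∑ i, α i • vecMat (xi N (p i)) := by
      funext i j
      simp only [vecMat, Finset.sum_apply, Matrix.sum_apply, Matrix.smul_apply, Pi.smul_apply]
    rw [this, Matrix.mul_sum]
    simp only [Matrix.mul_smul]
  rw [hexp, ← Finset.sum_filter_add_sum_filter_not _ (fun j => κ ∈ cr (p j))] at h
  have hnc : ∑ j with κ ∉ cr (p j), α j • (pullMat N e * vecMat (xi N (p j))) ∈ C.C 0 4 := by
    refine Submodule.sum_mem _ fun j hj => Submodule.smul_mem _ _ ?_
    rw [pullMat_mul_vecMat_xi (hFs j) (hF j)]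
    refine Submodule.smul_mem _ _ (hC _ _ (labelVec_mem_NCfam ?_))
    have hj := (Finset.mem_filter.1 hj).2
    rwa [mem_cr_iff _ hκ', hF, hF, hF] at hj
  have hcross := (Submodule.add_mem_iff_left _ hnc).1 h
  have hsum : ∑ j with κ ∈ cr (p j), α j • (pullMat N e * vecMat (xi N (p j))) =
      (∑ j, α j * (N : ℂ) ^ (n j - 2) * (if κ ∈ cr (p j) then (1 : ℂ) else 0)) •
        vecMat (labelVec N ![0, 1, 0, 1]) := by
    rw [Finset.sum_smul, Finset.sum_filter]
    refine Finset.sum_congr rfl fun j _ => ?_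
    split_ifs with hj
    · rw [pullMat_mul_vecMat_xi_of_mem_cr (hFs j) (hF j) hκ' hj, smul_smul, mul_one]
    · simp
  rw [hsum] at hcross
  exact (Submodule.smul_mem_iff _ hne).1 hcross

/-- for `N ≥ 4`, distinct partitions `p₁, …, p_m` of `[k]` and nonzero
`ξ = ∑ α_i ξ_{p_i}`, if the indicator vectors `η^κ ∈ ℂ^m` (over four-element subsets
`κ` of `[k]`, with `η^κ_j = 1` iff `κ ∈ cr(p_j)`) span `ℂ^m`, then `⟨NC, ξ⟩ = P`. -/
theorem stmt16 {N k m : ℕ} (hN : 4 ≤ N)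
    (p : Fin m → Finpartition (Finset.univ : Finset (Fin k)))
    (hinj : Function.Injective p)
    (α : Fin m → ℂ)
    (ξ : (Fin k → Fin N) → ℂ) (hξ : ξ = ∑ i, α i • xi N (p i)) (hne : ξ ≠ 0)
    (hspan : Submodule.span ℂ
      {v : Fin m → ℂ | ∃ κ : Finset (Fin k), κ.card = 4 ∧
        v = fun j => if κ ∈ cr (p j) then (1 : ℂ) else 0} = ⊤) :
    ∀ k' ℓ', genNCxi N ξ k' ℓ' = Pfam N k' ℓ' := by
  intro k' ℓ'
  subst hξ
  apply le_antisymm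
  · refine le_trans ?_ (invDual_le_Pfam N k' ℓ')
    refine iInf_le_of_le (invDual N) (iInf_le_of_le ?_ (iInf_le _ ?_))
    · exact fun a b => (NCfam_le_Pfam N a b).trans (Pfam_le_invDual N a b)
    · have h : vecMat (∑ i, α i • xi N (p i)) = ∑ i, α i • vecMat (xi N (p i)) := by
        funext i j
        simp only [vecMat, Finset.sum_apply, Matrix.sum_apply, Matrix.smul_apply, Pi.smul_apply]
      rw [h]
      exact Submodule.sum_mem _ fun i _ => Submodule.smul_mem _ _ (vecMat_xi_mem_invDual N (p i))
  · refine le_iInf fun C => le_iInf fun hC => le_iInf fun hξ => ?_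
    have hα : α ≠ 0 := by
      rintro rfl
      simp at hne
    exact Pfam_le_of_cross_mem C hC
      (cross_mem (by omega) p α hα hspan C hC hξ) k' ℓ'
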